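/- Consider the CLTSP with zero-processing times, no time constraints (τ(a) = 0, r(a) = 0 and d(a) = ∞ for all a ∈ A) and slow clients (0 < v < 1). Then there exists an optimal solution in which the clients of L are processed consecutively and the clients of R are processed consecutively, i.e., the server first serves all clients of one of the two sets and then all clients of the other set. -/

import Mathlib

open scoped BigOperators

/-- An instance of the collaborative line TSP/TRP: a finite set of `n` clients,
a client speed `v > 0`, and for each client a start position `s`, release date
`r ≥ 0`, deadline `d ∈ [0, ∞]` and processing time `tau ≥ 0`. -/
structure CInstance (n : ℕ) where
  v : ℝ
  s : Fin n → ℝ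
  r : Fin n → ℝ
  d : Fin n → EReal
  tau : Fin n → ℝ
  hv : 0 < v
  hr : ∀ a, 0 ≤ r a
  hd : ∀ a, (0 : EReal) ≤ d a
  htau : ∀ a, 0 ≤ tau a

/-- A solution: a serving order `σ` (the `i`-th rendezvous, `i = 0, …, n-1`
in zero-based counting, serves client `σ i`), a rendezvous time `t a` and a
rendezvous position `x a` for every client `a`, and a final time `tEnd` at
which the server is back at the origin. -/
structure CSolution (n : ℕ) where
  σ : Equiv.Perm (Fin n)
  t : Fin n → ℝ
  x : Fin n → ℝ
  tEnd : ℝ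

namespace CLTSP

variable {n : ℕ}

/-- Position `x_i` of the `i`-th server stop, `i = 0, …, n+1`; `x_0 = x_{n+1} = 0`. -/
def pos (sol : CSolution n) (i : ℕ) : ℝ :=
  if h : 1 ≤ i ∧ i ≤ n then sol.x (sol.σ ⟨i - 1, by omega⟩) else 0

/-- Time `t_i` of the `i`-th server stop, `i = 0, …, n+1`; `t_0 = 0`, `t_{n+1} = tEnd`. -/
def time (sol : CSolution n) (i : ℕ) : ℝ :=
  if h : 1 ≤ i ∧ i ≤ n then sol.t (sol.σ ⟨i - 1, by omega⟩)
  else if i = 0 then 0 else sol.tEnd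

/-- Completion time `c_i` of the `i`-th rendezvous: `c_0 = 0`,
`c_i = t_i + τ(σ_i)` for `1 ≤ i ≤ n`, and `c_{n+1} = tEnd`. -/
def comp (I : CInstance n) (sol : CSolution n) (i : ℕ) : ℝ :=
  if h : 1 ≤ i ∧ i ≤ n then
    sol.t (sol.σ ⟨i - 1, by omega⟩) + I.tau (sol.σ ⟨i - 1, by omega⟩)
  else if i = 0 then 0 else sol.tEnd

/-- Feasibility: every rendezvous (including the final return to the origin) is
reachable by the server, every rendezvous is reachable by the corresponding
client, and every client is served within its time window. -/
def Feasible (I : CInstance n) (sol : CSolution n) : Prop :=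
  (∀ i : ℕ, 1 ≤ i → i ≤ n + 1 →
      comp I sol (i - 1) + |pos sol i - pos sol (i - 1)| ≤ time sol i) ∧
  (∀ a, I.r a + |sol.x a - I.s a| / I.v ≤ sol.t a) ∧
  (∀ a, I.r a ≤ sol.t a ∧ (sol.t a : EReal) ≤ I.d a)

/-- The makespan `C_max = c_{n+1}`. -/
def makespan (sol : CSolution n) : ℝ := sol.tEnd

/-- The sum of completion times `C_sum = ∑_{i=1}^n c_i = ∑_a (t a + τ a)`. -/
def csum (I : CInstance n) (sol : CSolution n) : ℝ :=
  ∑ a : Fin n, (sol.t a + I.tau a)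

/-- An optimal CLTSP solution: feasible with minimum makespan. -/
def OptimalTSP (I : CInstance n) (sol : CSolution n) : Prop :=
  Feasible I sol ∧ ∀ sol' : CSolution n, Feasible I sol' → makespan sol ≤ makespan sol'

/-- An optimal CLTRP solution: feasible with minimum sum of completion times. -/
def OptimalTRP (I : CInstance n) (sol : CSolution n) : Prop :=
  Feasible I sol ∧ ∀ sol' : CSolution n, Feasible I sol' → csum I sol ≤ csum I sol'

/-- Order-preserving: for clients `a, a'` both in `L = {a : s a ≤ 0}` or both in
`R = {a : 0 < s a}` with `|s a| < |s a'|` we have `t a < t a'`. -/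
def OrderPreserving (I : CInstance n) (sol : CSolution n) : Prop :=
  ∀ a a' : Fin n,
    ((I.s a ≤ 0 ∧ I.s a' ≤ 0) ∨ (0 < I.s a ∧ 0 < I.s a')) →
    |I.s a| < |I.s a'| → sol.t a < sol.t a'

/-- Wait-free server: `t_i = c_{i-1} + |x_i - x_{i-1}|` for all `1 ≤ i ≤ n+1`. -/
def WaitFree (I : CInstance n) (sol : CSolution n) : Prop :=
  ∀ i : ℕ, 1 ≤ i → i ≤ n + 1 →
    time sol i = comp I sol (i - 1) + |pos sol i - pos sol (i - 1)|

/-- Colliding clients: each client `a = σ_i` satisfies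
`t a = max (r a + |s a - x a| / v) (c_{i-1})`. -/
def Colliding (I : CInstance n) (sol : CSolution n) : Prop :=
  ∀ a : Fin n,
    sol.t a = max (I.r a + |I.s a - sol.x a| / I.v)
      (comp I sol ((sol.σ.symm a : ℕ)))

end CLTSP

namespace CLTSP

variable {n : ℕ}

lemma pos_succ (sol : CSolution n) (k : Fin n) : pos sol (k + 1) = sol.x (sol.σ k) := by
  have h : 1 ≤ (k : ℕ) + 1 ∧ (k : ℕ) + 1 ≤ n := ⟨by omega, k.2⟩
  simp [pos, h]

lemma time_succ (sol : CSolution n) (k : Fin n) : time sol (k + 1) = sol.t (sol.σ k) := by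
  have h : 1 ≤ (k : ℕ) + 1 ∧ (k : ℕ) + 1 ≤ n := ⟨by omega, k.2⟩
  simp [time, h]

lemma pos_zero (sol : CSolution n) : pos sol 0 = 0 := by simp [pos]

lemma time_zero (sol : CSolution n) : time sol 0 = 0 := by simp [time]

lemma pos_last (sol : CSolution n) : pos sol (n + 1) = 0 := by simp [pos]

lemma time_last (sol : CSolution n) : time sol (n + 1) = sol.tEnd := by simp [time]

lemma comp_eq_time {I : CInstance n} (htau : ∀ a, I.tau a = 0) (sol : CSolution n) (i : ℕ) :
    comp I sol i = time sol i := by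
  simp [comp, time, htau]

/-- With zero processing times, any two server stops are at distance at most the elapsed time. -/
lemma Feasible.time_add_dist_le {I : CInstance n} (htau : ∀ a, I.tau a = 0) {sol : CSolution n}
    (h : Feasible I sol) {i j : ℕ} (hij : i ≤ j) (hj : j ≤ n + 1) :
    time sol i + |pos sol j - pos sol i| ≤ time sol j := by
  induction j, hij using Nat.le_induction with
  | base => simp
  | succ j hij ih =>
    have h₁ := ih (by omega)
    have h₂ := h.1 (j + 1) (by omega) hj
    rw [Nat.add_sub_cancel, comp_eq_time htau] at h₂
    have h₃ := abs_sub_le (pos sol (j + 1)) (pos sol j) (pos sol i)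
    linarith

lemma Feasible.dist_le {I : CInstance n} (htau : ∀ a, I.tau a = 0) {sol : CSolution n}
    (h : Feasible I sol) (a b : Fin n) : |sol.x a - sol.x b| ≤ |sol.t a - sol.t b| := by
  wlog hab : sol.σ.symm a ≤ sol.σ.symm b generalizing a b
  · rw [abs_sub_comm, abs_sub_comm (sol.t a)]
    exact this b a (le_of_not_ge hab)
  have := h.time_add_dist_le htau (i := sol.σ.symm a + 1) (j := sol.σ.symm b + 1)
    (by simpa using hab) (by omega)
  simp only [pos_succ, time_succ, Equiv.apply_symm_apply] at this
  rw [abs_sub_comm, abs_sub_comm (sol.t a)]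
  exact (by linarith : _ ≤ sol.t b - sol.t a).trans (le_abs_self _)

lemma Feasible.abs_position_le {I : CInstance n} (htau : ∀ a, I.tau a = 0) {sol : CSolution n}
    (h : Feasible I sol) (a : Fin n) : |sol.x a| ≤ sol.t a := by
  have := h.time_add_dist_le htau (i := 0) (j := sol.σ.symm a + 1) (by omega) (by omega)
  simpa [pos_succ, time_succ, pos_zero, time_zero] using this

lemma Feasible.add_abs_position_le {I : CInstance n} (htau : ∀ a, I.tau a = 0) {sol : CSolution n}
    (h : Feasible I sol) (a : Fin n) : sol.t a + |sol.x a| ≤ sol.tEnd := by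
  have := h.time_add_dist_le htau (i := sol.σ.symm a + 1) (j := n + 1) (by omega) (by omega)
  simpa [pos_succ, time_succ, pos_last, time_last] using this

lemma Feasible.tEnd_nonneg {I : CInstance n} (htau : ∀ a, I.tau a = 0) {sol : CSolution n}
    (h : Feasible I sol) : 0 ≤ sol.tEnd := by
  have := h.time_add_dist_le htau (i := 0) (j := n + 1) (by omega) (by omega)
  simpa [pos_zero, time_zero, pos_last, time_last] using this

/-- Rendezvous that are pairwise compatible with the unit speed of the server become a feasible
solution once they are sorted by time. -/
lemma exists_feasible_of_dist_le {I : CInstance n} (htau : ∀ a, I.tau a = 0)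
    (hrel : ∀ a, I.r a = 0) (hdead : ∀ a, I.d a = ⊤) (t x : Fin n → ℝ) {T : ℝ} (hT : 0 ≤ T)
    (hdist : ∀ a b, |x a - x b| ≤ |t a - t b|) (hstart : ∀ a, |x a| ≤ t a)
    (hend : ∀ a, t a + |x a| ≤ T) (hclient : ∀ a, |x a - I.s a| ≤ I.v * t a) :
    ∃ sol : CSolution n, Feasible I sol ∧ sol.tEnd = T ∧
      ∀ b c, t b < t c → (sol.σ.symm b : ℕ) < (sol.σ.symm c : ℕ) := by
  have hmono : Monotone (t ∘ Tuple.sort t) := Tuple.monotone_sort t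
  refine ⟨⟨Tuple.sort t, t, x, T⟩, ⟨?_, ?_, ?_⟩, rfl, ?_⟩
  · intro i hi hin
    rw [comp_eq_time htau]
    obtain ⟨i, rfl⟩ : ∃ j, i = j + 1 := ⟨i - 1, by omega⟩
    rw [Nat.add_sub_cancel]
    rcases Nat.eq_zero_or_pos i with rfl | hi0
    · rcases Nat.eq_zero_or_pos n with rfl | hn
      · simpa [pos, time] using hT
      · have h₁ := pos_succ ⟨Tuple.sort t, t, x, T⟩ ⟨0, hn⟩
        have h₂ := time_succ ⟨Tuple.sort t, t, x, T⟩ ⟨0, hn⟩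
        simp only at h₁ h₂
        rw [h₁, h₂, pos_zero, time_zero]
        simpa using hstart _
    · obtain ⟨i, rfl⟩ : ∃ j, i = j + 1 := ⟨i - 1, by omega⟩
      have h₁ := pos_succ ⟨Tuple.sort t, t, x, T⟩ ⟨i, by omega⟩
      have h₂ := time_succ ⟨Tuple.sort t, t, x, T⟩ ⟨i, by omega⟩
      simp only at h₁ h₂
      rw [h₁, h₂]
      rcases Nat.lt_or_ge (i + 1) n with hlt | hge
      · have h₃ := pos_succ ⟨Tuple.sort t, t, x, T⟩ ⟨i + 1, hlt⟩
        have h₄ := time_succ ⟨Tuple.sort t, t, x, T⟩ ⟨i + 1, hlt⟩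
        simp only at h₃ h₄
        rw [h₃, h₄]
        have hm : (t ∘ Tuple.sort t) ⟨i, by omega⟩ ≤ (t ∘ Tuple.sort t) ⟨i + 1, hlt⟩ :=
          hmono (by simp)
        have hd := hdist (Tuple.sort t ⟨i + 1, hlt⟩) (Tuple.sort t ⟨i, by omega⟩)
        simp only [Function.comp] at hm
        rw [abs_of_nonneg (sub_nonneg.2 hm)] at hd
        linarith
      · obtain rfl : n = i + 1 := by omega
        rw [pos_last, time_last]
        simpa using hend _
  · intro a
    rw [hrel, zero_add, div_le_iff₀ I.hv, mul_comm]
    exact hclient a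
  · intro a
    rw [hrel, hdead]
    exact ⟨(abs_nonneg _).trans (hstart a), le_top⟩
  · intro b c hbc
    by_contra! hle
    have h := hmono (show (Tuple.sort t).symm c ≤ (Tuple.sort t).symm b from hle)
    simp only [Function.comp, Equiv.apply_symm_apply] at h
    exact absurd h (not_le.2 hbc)

/-- The makespan of serving a side with farthest distance `p` first and the other side, with
farthest distance `q`, afterwards, the clients having speed `v`. -/
noncomputable def twoSweepMakespan (v p q : ℝ) : ℝ :=
  max (2 * p / (1 + v)) ((2 * q + (1 - v) * (2 * p / (1 + v))) / (1 + v))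

lemma exists_feasible_twoSweep {I : CInstance n} (htau : ∀ a, I.tau a = 0)
    (hrel : ∀ a, I.r a = 0) (hdead : ∀ a, I.d a = ⊤) {ε : ℝ} (hε : |ε| = 1) (P : Fin n → Prop)
    (hP : ∀ a, P a → 0 ≤ ε * I.s a) (hN : ∀ a, ¬ P a → ε * I.s a ≤ 0)
    (hne : ∀ a b, P a → ¬ P b → I.s a ≠ I.s b) {p q : ℝ} (hp0 : 0 ≤ p)
    (hp : ∀ a, ε * I.s a ≤ p) (hq : ∀ a, -(ε * I.s a) ≤ q) :
    ∃ sol : CSolution n, Feasible I sol ∧ sol.tEnd = twoSweepMakespan I.v p q ∧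
      ∀ b c, P b → ¬ P c → (sol.σ.symm b : ℕ) < (sol.σ.symm c : ℕ) := by
  classical
  have hv := I.hv
  have hv1 : 0 < 1 + I.v := by linarith
  have hεε : ε * ε = 1 := by rw [← abs_mul_abs_self, hε, one_mul]
  set T₁ := 2 * p / (1 + I.v) with hT₁
  have hT₁0 : 0 ≤ T₁ := by positivity
  let t : Fin n → ℝ := fun a =>
    if P a then ε * I.s a / (1 + I.v) else max T₁ ((-(ε * I.s a) + T₁) / (1 + I.v))
  let y : Fin n → ℝ := fun a => if P a then t a else T₁ - t a
  have htP : ∀ a, P a → t a * (1 + I.v) = ε * I.s a ∧ y a = t a ∧ 0 ≤ t a ∧ 2 * t a ≤ T₁ := by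
    intro a ha
    have e : t a = ε * I.s a / (1 + I.v) := if_pos ha
    refine ⟨by rw [e]; field_simp, if_pos ha, by rw [e]; exact div_nonneg (hP a ha) hv1.le, ?_⟩
    rw [e, hT₁, ← mul_div_assoc]
    gcongr
    exact hp a
  have htN : ∀ a, ¬ P a → T₁ ≤ t a ∧ -(ε * I.s a) + T₁ ≤ t a * (1 + I.v) ∧ y a = T₁ - t a ∧
      (t a = T₁ ∨ t a * (1 + I.v) = -(ε * I.s a) + T₁) := by
    intro a ha
    have e : t a = max T₁ ((-(ε * I.s a) + T₁) / (1 + I.v)) := if_neg ha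
    refine ⟨e ▸ le_max_left _ _, ?_, if_neg ha, ?_⟩
    · rw [← div_le_iff₀ hv1, e]
      exact le_max_right _ _
    · rcases max_choice T₁ ((-(ε * I.s a) + T₁) / (1 + I.v)) with h | h
      · exact Or.inl (e.trans h)
      · exact Or.inr (by rw [e, h]; field_simp)
  have hT : T₁ ≤ twoSweepMakespan I.v p q := le_max_left _ _
  have hT' : 2 * q + (1 - I.v) * T₁ ≤ twoSweepMakespan I.v p q * (1 + I.v) := by
    rw [← div_le_iff₀ hv1]
    exact le_max_right _ _
  have habs : ∀ z : ℝ, |ε * z| = |z| := fun z => by rw [abs_mul, hε, one_mul]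
  have hmixed : ∀ a b, P a → ¬ P b → |y a - y b| ≤ |t a - t b| := by
    intro a b ha hb
    obtain ⟨-, h₁, h₂, h₃⟩ := htP a ha
    obtain ⟨h₄, -, h₅, -⟩ := htN b hb
    rw [h₁, h₅, abs_sub_comm (t a) (t b), abs_of_nonneg (by linarith : 0 ≤ t b - t a)]
    exact abs_le.2 ⟨by linarith, by linarith⟩
  obtain ⟨sol, hsol, hend, hord⟩ := exists_feasible_of_dist_le htau hrel hdead t
    (fun a => ε * y a) (T := twoSweepMakespan I.v p q) (hT₁0.trans hT)
    (fun a b => by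
      rw [← mul_sub, habs]
      by_cases ha : P a <;> by_cases hb : P b
      · rw [(htP a ha).2.1, (htP b hb).2.1]
      · exact hmixed a b ha hb
      · rw [abs_sub_comm, abs_sub_comm (t a)]
        exact hmixed b a hb ha
      · rw [(htN a ha).2.2.1, (htN b hb).2.2.1, sub_sub_sub_cancel_left, abs_sub_comm])
    (fun a => by
      rw [habs]
      by_cases ha : P a
      · obtain ⟨-, h₁, h₂, -⟩ := htP a ha
        rw [h₁, abs_of_nonneg h₂]
      · obtain ⟨h₁, -, h₂, -⟩ := htN a ha
        rw [h₂]
        exact abs_le.2 ⟨by linarith, by linarith⟩)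
    (fun a => by
      rw [habs]
      by_cases ha : P a
      · obtain ⟨-, h₁, h₂, h₃⟩ := htP a ha
        rw [h₁, abs_of_nonneg h₂]
        linarith
      · obtain ⟨h₁, -, h₂, h₃⟩ := htN a ha
        rw [h₂, abs_of_nonpos (by linarith)]
        rcases h₃ with h₃ | h₃
        · linarith
        · refine le_of_mul_le_mul_right ?_ hv1
          linarith [hq a])
    (fun a => by
      have e : ε * y a - I.s a = ε * (y a - ε * I.s a) := by
        linear_combination I.s a * hεε
      rw [e, habs]
      by_cases ha : P a
      · obtain ⟨h₀, h₁, h₂, -⟩ := htP a ha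
        have := mul_nonneg hv.le h₂
        rw [h₁]
        exact abs_le.2 ⟨by linarith, by linarith⟩
      · obtain ⟨h₁, h₂, h₃, h₄⟩ := htN a ha
        have h₅ := hN a ha
        have := mul_nonneg hv.le (hT₁0.trans h₁)
        rw [h₃]
        refine abs_le.2 ⟨?_, by linarith⟩
        rcases h₄ with h₄ | h₄ <;> linarith)
  refine ⟨sol, hsol, hend, fun b c hb hc => hord b c ?_⟩
  obtain ⟨h₀, -, h₂, h₃⟩ := htP b hb
  obtain ⟨h₄, h₅, -, -⟩ := htN c hc
  rcases h₂.lt_or_eq with h | h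
  · linarith
  · have hc0 : ε * I.s c ≠ 0 := by
      intro hc0
      have hb0 : ε * I.s b = 0 := by rw [← h₀, ← h, zero_mul]
      have hε0 : ε ≠ 0 := by rintro rfl; simp at hεε
      exact hne b c hb hc (mul_left_cancel₀ hε0 (hb0.trans hc0.symm))
    have hc1 := lt_of_le_of_ne (hN c hc) hc0
    rw [← h]
    exact pos_of_mul_pos_left (by linarith) hv1.le

/-- Lower bound on the return time `T` of a unit-speed server that meets a client from `p` at
`(t₁, x₁)` and a client from `-q` at a later `(t₂, x₂)`. -/
lemma twoSweepMakespan_le {v p q t₁ x₁ t₂ x₂ T : ℝ} (hv : 0 < v) (hslow : v < 1)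
    (h₁ : p - x₁ ≤ v * t₁) (hx₁ : |x₁| ≤ t₁) (hT₁ : t₁ + |x₁| ≤ T)
    (h₂ : x₂ + q ≤ v * t₂) (hT₂ : t₂ + |x₂| ≤ T)
    (h : x₁ - x₂ ≤ t₂ - t₁) : twoSweepMakespan v p q ≤ T := by
  have hv1 : 0 < 1 + v := by linarith
  have hx₁' := le_abs_self x₁
  have hx₂' := neg_abs_le x₂
  have ha : 2 * p / (1 + v) ≤ 2 * t₁ := by
    rw [div_le_iff₀ hv1]
    linarith
  have hb : 2 * p / (1 + v) ≤ T := by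
    rw [div_le_iff₀ hv1]
    nlinarith
  refine max_le hb ?_
  have e : 2 * p / (1 + v) * (1 + v) = 2 * p := by field_simp
  set T₁ := 2 * p / (1 + v)
  have hc : q + T₁ ≤ (1 + v) * t₂ := by nlinarith
  rw [div_le_iff₀ hv1]
  nlinarith

/-- The farthest distance on one side is attained, unless it is zero. -/
lemma exists_max_or_zero (f : Fin n → ℝ) :
    ∃ p, 0 ≤ p ∧ (∀ a, f a ≤ p) ∧ (p = 0 ∨ ∃ a, f a = p) := by
  by_cases h : ∃ a, 0 ≤ f a
  · obtain ⟨a₀, h₀⟩ := h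
    have : Nonempty (Fin n) := ⟨a₀⟩
    obtain ⟨a, ha⟩ := Finite.exists_max f
    exact ⟨f a, h₀.trans (ha a₀), ha, Or.inr ⟨a, rfl⟩⟩
  · push Not at h
    exact ⟨0, le_rfl, fun a => (h a).le, Or.inl rfl⟩

lemma Feasible.twoSweepMakespan_le_or {I : CInstance n} (htau : ∀ a, I.tau a = 0)
    (hrel : ∀ a, I.r a = 0) (hslow : I.v < 1) {p q : ℝ} (hp : p = 0 ∨ ∃ a, I.s a = p)
    (hq : q = 0 ∨ ∃ a, -I.s a = q) {sol : CSolution n} (h : Feasible I sol) :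
    twoSweepMakespan I.v p q ≤ sol.tEnd ∨ twoSweepMakespan I.v q p ≤ sol.tEnd := by
  have hv := I.hv
  have hclient : ∀ a, |sol.x a - I.s a| ≤ I.v * sol.t a := fun a => by
    have := h.2.1 a
    rwa [hrel, zero_add, div_le_iff₀ hv, mul_comm] at this
  have hT := h.tEnd_nonneg htau
  have key : ∃ t₁ x₁ t₂ x₂ : ℝ, (p - x₁ ≤ I.v * t₁ ∧ |x₁| ≤ t₁ ∧ t₁ + |x₁| ≤ sol.tEnd) ∧
      (x₂ + q ≤ I.v * t₂ ∧ |x₂| ≤ t₂ ∧ t₂ + |x₂| ≤ sol.tEnd) ∧ |x₁ - x₂| ≤ |t₁ - t₂| := by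
    rcases hp with rfl | ⟨a, rfl⟩ <;> rcases hq with rfl | ⟨b, rfl⟩
    · exact ⟨0, 0, 0, 0, by simpa using hT, by simpa using hT, by simp⟩
    · have := abs_le.1 (hclient b)
      refine ⟨0, 0, sol.t b, sol.x b, by simpa using hT,
        ⟨by linarith, h.abs_position_le htau b, h.add_abs_position_le htau b⟩, ?_⟩
      simpa using (h.abs_position_le htau b).trans (le_abs_self _)
    · have := abs_le.1 (hclient a)
      refine ⟨sol.t a, sol.x a, 0, 0, ⟨by linarith, h.abs_position_le htau a, h.add_abs_position_le htau a⟩,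
        by simpa using hT, ?_⟩
      simpa using (h.abs_position_le htau a).trans (le_abs_self _)
    · have := abs_le.1 (hclient a)
      have := abs_le.1 (hclient b)
      exact ⟨sol.t a, sol.x a, sol.t b, sol.x b,
        ⟨by linarith, h.abs_position_le htau a, h.add_abs_position_le htau a⟩,
        ⟨by linarith, h.abs_position_le htau b, h.add_abs_position_le htau b⟩, h.dist_le htau a b⟩
  obtain ⟨t₁, x₁, t₂, x₂, ⟨hp₁, hp₂, hp₃⟩, ⟨hq₁, hq₂, hq₃⟩, hd⟩ := key
  rcases le_total t₁ t₂ with ht | ht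
  · left
    rw [abs_sub_comm t₁, abs_of_nonneg (sub_nonneg.2 ht)] at hd
    exact twoSweepMakespan_le hv hslow hp₁ hp₂ hp₃ hq₁ hq₃ ((le_abs_self _).trans hd)
  · right
    rw [abs_of_nonneg (sub_nonneg.2 ht)] at hd
    have := (le_abs_self _).trans hd
    refine twoSweepMakespan_le (t₁ := t₂) (x₁ := -x₂) (t₂ := t₁) (x₂ := -x₁) hv hslow (by linarith) (by rwa [abs_neg])
      (by rwa [abs_neg]) (by linarith) (by rwa [abs_neg]) (by linarith)

end CLTSP

open CLTSP in
/-- CLTSP with zero processing times, no time constraints and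
slow clients: there exists an optimal solution in which the clients of `L` and
of `R` are processed consecutively, i.e. the server first serves all clients of
one of the two sets and then all clients of the other. -/
theorem cltsp_zeroProc_noConstraints_slow_exists_consecutive_optimal
    {n : ℕ} (I : CInstance n)
    (htau : ∀ a, I.tau a = 0) (hrel : ∀ a, I.r a = 0) (hdead : ∀ a, I.d a = ⊤)
    (hslow : I.v < 1) :
    ∃ sol : CSolution n, OptimalTSP I sol ∧
      ((∀ b c : Fin n, I.s b ≤ 0 → 0 < I.s c →
          (sol.σ.symm b : ℕ) < (sol.σ.symm c : ℕ)) ∨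
       (∀ b c : Fin n, 0 < I.s b → I.s c ≤ 0 →
          (sol.σ.symm b : ℕ) < (sol.σ.symm c : ℕ))) := by
  obtain ⟨p, hp0, hp, hp'⟩ := exists_max_or_zero I.s
  obtain ⟨q, hq0, hq, hq'⟩ := exists_max_or_zero fun a => -I.s a
  have hlower := fun (sol : CSolution n) (h : Feasible I sol) =>
    h.twoSweepMakespan_le_or htau hrel hslow hp' hq'
  rcases le_total (twoSweepMakespan I.v p q) (twoSweepMakespan I.v q p) with hle | hle
  · obtain ⟨sol, hsol, hend, hord⟩ := exists_feasible_twoSweep htau hrel hdead (ε := 1) (by simp)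
      (fun a => 0 < I.s a) (fun a ha => by simpa using ha.le) (fun a ha => by simpa using ha)
      (fun a b ha hb => (lt_of_le_of_lt (not_lt.1 hb) ha).ne') hp0 (by simpa using hp)
      (by simpa using hq)
    refine ⟨sol, ⟨hsol, fun sol' h' => ?_⟩, Or.inr fun b c hb hc => hord b c hb (not_lt.2 hc)⟩
    change sol.tEnd ≤ sol'.tEnd
    rw [hend]
    exact (hlower sol' h').elim id hle.trans
  · obtain ⟨sol, hsol, hend, hord⟩ := exists_feasible_twoSweep htau hrel hdead (ε := -1) (by simp)
      (fun a => I.s a ≤ 0) (fun a ha => by simpa using ha)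
      (fun a ha => by simpa using (not_le.1 ha).le)
      (fun a b ha hb => (lt_of_le_of_lt ha (not_le.1 hb)).ne) hq0 (by simpa using hq)
      (by simpa using hp)
    refine ⟨sol, ⟨hsol, fun sol' h' => ?_⟩, Or.inl fun b c hb hc => hord b c hb (not_le.2 hc)⟩
    change sol.tEnd ≤ sol'.tEnd
    rw [hend]
    exact (hlower sol' h').elim hle.trans id
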